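/- Let N ≥ 1, let w₁, …, w_N > 0 with Σₖ wₖ = 1, and let μ₁, …, μ_N ∈ ℝ and σ₁, …, σ_N > 0. Define τ* = (Σₖ wₖ σₖ⁻²)⁻¹ and μ* = τ*·Σₖ wₖ σₖ⁻² μₖ. Then the function (μ, τ) ↦ Σₖ wₖ · klDiv(N(μ, τ), N(μₖ, σₖ²)), defined for μ ∈ ℝ and τ > 0 with values in ℝ≥0∞, attains its minimum over ℝ × (0, ∞) at (μ*, τ*), and this minimizer is unique. -/

import Mathlib

open MeasureTheory ProbabilityTheory Real
open scoped ENNReal NNReal Classical BigOperators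

/-- Kullback–Leibler divergence of `μ` from `ν`, with values in `ℝ≥0∞`. -/
noncomputable def klDiv {Ω : Type*} [MeasurableSpace Ω] (μ ν : Measure Ω) : ℝ≥0∞ :=
  if μ ≪ ν ∧ Integrable (llr μ ν) μ then ENNReal.ofReal (∫ x, llr μ ν x ∂μ) else ⊤

/-- Closed form of the Kullback–Leibler divergence of `N(μ, τ)` from `N(m, v)`. -/
noncomputable def gaussianKL (μ τ m v : ℝ) : ℝ :=
  (τ / v - 1 - Real.log (τ / v) + (μ - m) ^ 2 / v) / 2

lemma gaussianKL_nonneg (μ m : ℝ) {τ v : ℝ} (hτ : 0 < τ) (hv : 0 < v) :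
    0 ≤ gaussianKL μ τ m v := by
  have h1 := Real.log_le_sub_one_of_pos (div_pos hτ hv)
  have h2 : 0 ≤ (μ - m) ^ 2 / v := by positivity
  unfold gaussianKL
  linarith

lemma eq_and_eq_of_gaussianKL_nonpos {μ m τ v : ℝ} (hτ : 0 < τ) (hv : 0 < v)
    (h : gaussianKL μ τ m v ≤ 0) : μ = m ∧ τ = v := by
  have h1 := Real.log_le_sub_one_of_pos (div_pos hτ hv)
  have h2 : 0 ≤ (μ - m) ^ 2 / v := by positivity
  unfold gaussianKL at h
  constructor
  · have h3 : (μ - m) ^ 2 / v = 0 := by linarith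
    rw [div_eq_zero_iff, or_iff_left hv.ne', sq_eq_zero_iff, sub_eq_zero] at h3
    exact h3
  · by_contra hne
    have hne' : τ / v ≠ 1 := by rwa [Ne, div_eq_one_iff_eq hv.ne']
    have h3 := Real.log_lt_sub_one_of_pos (div_pos hτ hv) hne'
    linarith

lemma rnDeriv_gaussianReal_gaussianReal (μ m : ℝ) (τ : ℝ≥0) {v : ℝ≥0} (hv : v ≠ 0) :
    (gaussianReal μ τ).rnDeriv (gaussianReal m v) =ᵐ[volume]
      fun x ↦ (gaussianPDF m v x)⁻¹ * gaussianPDF μ τ x := by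
  rw [gaussianReal_of_var_ne_zero m hv]
  have h := Measure.rnDeriv_withDensity_right (gaussianReal μ τ) volume
    (measurable_gaussianPDF m v).aemeasurable
    (.of_forall fun x ↦ (gaussianPDF_pos m hv x).ne') (.of_forall fun x ↦ gaussianPDF_ne_top)
  filter_upwards [h, rnDeriv_gaussianReal μ τ] with x hx hx'
  rw [hx, hx']

lemma log_gaussianPDFReal (μ x : ℝ) {v : ℝ≥0} (hv : v ≠ 0) :
    Real.log (gaussianPDFReal μ v x) =
      -(Real.log (2 * π * v) / 2) - (x - μ) ^ 2 / (2 * v) := by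
  have hv' : (0 : ℝ) < v := by positivity
  rw [gaussianPDFReal, Real.log_mul (by positivity) (Real.exp_ne_zero _), Real.log_inv,
    Real.log_sqrt (by positivity), Real.log_exp]
  ring

lemma llr_gaussianReal_gaussianReal (μ m : ℝ) {τ v : ℝ≥0} (hτ : τ ≠ 0) (hv : v ≠ 0) :
    llr (gaussianReal μ τ) (gaussianReal m v) =ᵐ[gaussianReal μ τ]
      fun x ↦ -(Real.log (τ / v) / 2) - (x - μ) ^ 2 / (2 * τ) + (x - m) ^ 2 / (2 * v) := by
  have hτ' : (0 : ℝ) < τ := by positivity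
  have hv' : (0 : ℝ) < v := by positivity
  filter_upwards [(gaussianReal_absolutelyContinuous μ hτ).ae_le
    (rnDeriv_gaussianReal_gaussianReal μ m τ hv)] with x hx
  rw [llr, hx, ENNReal.toReal_mul, ENNReal.toReal_inv, toReal_gaussianPDF, toReal_gaussianPDF,
    Real.log_mul (inv_ne_zero (gaussianPDFReal_pos m v x hv).ne')
      (gaussianPDFReal_pos μ τ x hτ).ne', Real.log_inv, log_gaussianPDFReal _ _ hv,
    log_gaussianPDFReal _ _ hτ, Real.log_mul (by positivity) hv'.ne',
    Real.log_mul (by positivity) hτ'.ne', Real.log_div hτ'.ne' hv'.ne']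
  ring

lemma integrable_sub_sq_gaussianReal (μ c : ℝ) (τ : ℝ≥0) :
    Integrable (fun x ↦ (x - c) ^ 2) (gaussianReal μ τ) :=
  ((memLp_id_gaussianReal (μ := μ) (v := τ) 2).sub (memLp_const c)).integrable_sq

lemma integral_sub_sq_gaussianReal (μ c : ℝ) (τ : ℝ≥0) :
    ∫ x, (x - c) ^ 2 ∂gaussianReal μ τ = τ + (μ - c) ^ 2 := by
  have hvar : ∫ x, (x - μ) ^ 2 ∂gaussianReal μ τ = τ := by
    have h := variance_fun_id_gaussianReal (μ := μ) (v := τ)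
    rwa [variance_eq_integral measurable_id'.aemeasurable, integral_id_gaussianReal] at h
  have h_id : Integrable (fun x : ℝ ↦ x) (gaussianReal μ τ) :=
    (memLp_id_gaussianReal (μ := μ) (v := τ) 1).integrable (by simp)
  have hexp : (fun x : ℝ ↦ (x - c) ^ 2) = fun x ↦
      (x - μ) ^ 2 + (2 * (μ - c) * x + ((μ - c) ^ 2 - 2 * (μ - c) * μ)) := by
    ext x
    ring
  rw [hexp, integral_add (integrable_sub_sq_gaussianReal μ μ τ)
      (by exact (h_id.const_mul _).add (integrable_const _)),
    integral_add (h_id.const_mul _) (integrable_const _), integral_const_mul, hvar,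
    integral_id_gaussianReal]
  simp

lemma klDiv_gaussianReal (μ m : ℝ) {τ v : ℝ≥0} (hτ : τ ≠ 0) (hv : v ≠ 0) :
    klDiv (gaussianReal μ τ) (gaussianReal m v) = ENNReal.ofReal (gaussianKL μ τ m v) := by
  have hllr := llr_gaussianReal_gaussianReal μ m hτ hv
  have hconst : Integrable (fun _ : ℝ ↦ -(Real.log (τ / v) / 2)) (gaussianReal μ τ) :=
    integrable_const _
  have h1 := (integrable_sub_sq_gaussianReal μ μ τ).div_const (2 * (τ : ℝ))
  have h2 := (integrable_sub_sq_gaussianReal μ m τ).div_const (2 * (v : ℝ))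
  have h3 : Integrable (fun x ↦ -(Real.log (τ / v) / 2) - (x - μ) ^ 2 / (2 * (τ : ℝ)))
      (gaussianReal μ τ) := hconst.sub h1
  have hac : gaussianReal μ τ ≪ gaussianReal m v :=
    (gaussianReal_absolutelyContinuous μ hτ).trans (gaussianReal_absolutelyContinuous' m hv)
  rw [klDiv, if_pos ⟨hac, (h3.add h2).congr hllr.symm⟩, integral_congr_ae hllr,
    integral_add h3 h2, integral_sub hconst h1, integral_div, integral_div,
    integral_sub_sq_gaussianReal, integral_sub_sq_gaussianReal]
  have hτ' : (τ : ℝ) ≠ 0 := by exact_mod_cast hτ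
  have hv' : (v : ℝ) ≠ 0 := by exact_mod_cast hv
  congr 1
  simp only [integral_const, probReal_univ, one_smul, gaussianKL]
  field_simp
  ring

/-- Pythagorean identity: the weighted divergence exceeds its value at the precision-weighted
barycenter by the divergence from the barycenter. -/
lemma sum_mul_gaussianKL {ι : Type*} [Fintype ι] {w m v : ι → ℝ} (hw1 : ∑ k, w k = 1)
    (hv : ∀ k, 0 < v k) {τ₀ μ₀ : ℝ} (hτ₀ : 0 < τ₀) (hprec : ∑ k, w k * (v k)⁻¹ = τ₀⁻¹)
    (hmean : ∑ k, w k * (v k)⁻¹ * m k = τ₀⁻¹ * μ₀) (μ : ℝ) {τ : ℝ} (hτ : 0 < τ) :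
    ∑ k, w k * gaussianKL μ τ (m k) (v k) =
      ∑ k, w k * gaussianKL μ₀ τ₀ (m k) (v k) + gaussianKL μ τ μ₀ τ₀ := by
  rw [← sub_eq_iff_eq_add', ← Finset.sum_sub_distrib]
  have hterm : ∀ k, w k * gaussianKL μ τ (m k) (v k) - w k * gaussianKL μ₀ τ₀ (m k) (v k) =
      (w k * (v k)⁻¹) * ((τ - τ₀ + μ ^ 2 - μ₀ ^ 2) / 2) - (w k * (v k)⁻¹ * m k) * (μ - μ₀)
        - w k * ((Real.log τ - Real.log τ₀) / 2) := fun k ↦ by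
    rw [gaussianKL, gaussianKL, Real.log_div hτ.ne' (hv k).ne',
      Real.log_div hτ₀.ne' (hv k).ne']
    ring
  simp_rw [hterm, Finset.sum_sub_distrib, ← Finset.sum_mul]
  rw [hprec, hmean, hw1, gaussianKL, Real.log_div hτ.ne' hτ₀.ne']
  field_simp
  ring

/-- Closed-form Reverse-KL barycenter of one-dimensional Gaussians
(equation (5) of the paper): the map
`(μ, τ) ↦ Σₖ wₖ · klDiv (N(μ, τ)) (N(μₖ, σₖ²))`, for `τ > 0`, attains its minimum at
`τ* = (Σₖ wₖ σₖ⁻²)⁻¹`, `μ* = τ* Σₖ wₖ σₖ⁻² μₖ`, and the minimizer is unique. -/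
theorem stmt8 (N : ℕ) (hN : 1 ≤ N) (w : Fin N → ℝ) (hw : ∀ k, 0 < w k)
    (hw1 : ∑ k, w k = 1) (m : Fin N → ℝ) (s : Fin N → ℝ) (hs : ∀ k, 0 < s k)
    (τstar μstar : ℝ)
    (hτstar : τstar = (∑ k, w k * (s k ^ 2)⁻¹)⁻¹)
    (hμstar : μstar = τstar * ∑ k, w k * (s k ^ 2)⁻¹ * m k)
    (F : ℝ → ℝ → ℝ≥0∞)
    (hF : ∀ μ τ, F μ τ =
      ∑ k, ENNReal.ofReal (w k) *
        klDiv (gaussianReal μ (Real.toNNReal τ)) (gaussianReal (m k) ((s k ^ 2).toNNReal))) :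
    (∀ μ τ, 0 < τ → F μstar τstar ≤ F μ τ) ∧
      (∀ μ τ, 0 < τ → F μ τ ≤ F μstar τstar → μ = μstar ∧ τ = τstar) := by

  have hv : ∀ k, 0 < s k ^ 2 := fun k ↦ pow_pos (hs k) 2
  have : Nonempty (Fin N) := ⟨⟨0, hN⟩⟩
  have hsum : 0 < ∑ k, w k * (s k ^ 2)⁻¹ :=
    Finset.sum_pos (fun k _ ↦ mul_pos (hw k) (inv_pos.2 (hv k))) Finset.univ_nonempty
  have hτ₀ : 0 < τstar := hτstar ▸ inv_pos.2 hsum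
  have hprec : ∑ k, w k * (s k ^ 2)⁻¹ = τstar⁻¹ := by rw [hτstar, inv_inv]
  have hmean : ∑ k, w k * (s k ^ 2)⁻¹ * m k = τstar⁻¹ * μstar := by
    rw [hμstar, inv_mul_cancel_left₀ hτ₀.ne']
  have hnonneg : ∀ μ τ, 0 < τ → ∀ k, 0 ≤ w k * gaussianKL μ τ (m k) (s k ^ 2) :=
    fun μ τ hτ k ↦ mul_nonneg (hw k).le (gaussianKL_nonneg _ _ hτ (hv k))
  have hF' : ∀ μ τ, 0 < τ →
      F μ τ = ENNReal.ofReal (∑ k, w k * gaussianKL μ τ (m k) (s k ^ 2)) := by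
    intro μ τ hτ
    rw [hF, ENNReal.ofReal_sum_of_nonneg fun k _ ↦ hnonneg μ τ hτ k]
    refine Finset.sum_congr rfl fun k _ ↦ ?_
    rw [klDiv_gaussianReal _ _ (Real.toNNReal_pos.2 hτ).ne' (Real.toNNReal_pos.2 (hv k)).ne',
      Real.coe_toNNReal _ hτ.le, Real.coe_toNNReal _ (hv k).le, ENNReal.ofReal_mul (hw k).le]
  have hpyth := fun μ τ hτ ↦ sum_mul_gaussianKL hw1 hv hτ₀ hprec hmean μ (τ := τ) hτ
  refine ⟨fun μ τ hτ ↦ ?_, fun μ τ hτ hle ↦ ?_⟩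
  · rw [hF' _ _ hτ, hF' _ _ hτ₀, hpyth μ τ hτ]
    exact ENNReal.ofReal_le_ofReal
      (le_add_of_nonneg_right (gaussianKL_nonneg _ _ hτ hτ₀))
  · rw [hF' _ _ hτ, hF' _ _ hτ₀, hpyth μ τ hτ, ENNReal.ofReal_le_ofReal_iff
      (Finset.sum_nonneg fun k _ ↦ hnonneg _ _ hτ₀ k)] at hle
    exact eq_and_eq_of_gaussianKL_nonpos hτ hτ₀ (by linarith)
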